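/- Let H(ζ, s) = m(m−α₁) G(ζ,s) G_{ss}(ζ,s) + α₂(α₁−α₂) s G_s(ζ,s) G_{ss}(ζ,s) − (m−α₂)² G_s(ζ,s)², where G(ζ,s) = ⟨φ(1,s), ζ⟩. Then, under hypotheses (H1)–(H3): (i) there exist a positive integer n₁ and constants D > 0, δ > 0 such that |H(ζ,s)| ≥ D|s − σ|^{n₁} for all s ∈ (σ − δ, σ) and all ζ ∈ S¹, when σ ∈ (c,d]; (ii) there exist a positive integer n₂ and constants D > 0, δ > 0 such that |H(ζ,s)| ≥ D|s − σ|^{n₂} for all s ∈ (σ, σ + δ) and all ζ ∈ S¹, when σ ∈ [c,d); and (iii) for every closed interval I ⊂ [c,d] \ {σ} there exists D̃ > 0 such that |H(ζ,s)| ≥ D̃ for all s ∈ I and all ζ ∈ S¹. -/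

import Mathlib

open MeasureTheory Real Set
open scoped ENNReal

noncomputable section

/-- Nonisotropic dilation `t ∙ x = (t^{α₁} x₁, t^{α₂} x₂)` (for `t > 0`). -/
def dil (α₁ α₂ t : ℝ) (x : Fin 2 → ℝ) : Fin 2 → ℝ :=
  ![t ^ α₁ * x 0, t ^ α₂ * x 1]

/-- The region `V^{a,b} = { t ∙ (1,s) : s ∈ (a,b), t > 0 }`. -/
def Vab (α₁ α₂ a b : ℝ) : Set (Fin 2 → ℝ) :=
  {x | ∃ s t : ℝ, a < s ∧ s < b ∧ 0 < t ∧ x = dil α₁ α₂ t ![1, s]}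

/-- The region `V₁^{c,d} = { t ∙ (1,s) : s ∈ (c,d), 0 < t < 1 }`. -/
def V1 (α₁ α₂ c d : ℝ) : Set (Fin 2 → ℝ) :=
  {x | ∃ s t : ℝ, c < s ∧ s < d ∧ 0 < t ∧ t < 1 ∧ x = dil α₁ α₂ t ![1, s]}

/-- Membership in the unit circle `S¹ ⊂ ℝ²`. -/
def onS1 (ζ : Fin 2 → ℝ) : Prop := ζ 0 ^ 2 + ζ 1 ^ 2 = 1

/-- The standard inner product on `ℝ²`. -/
def dot2 (u v : Fin 2 → ℝ) : ℝ := u 0 * v 0 + u 1 * v 1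

/-- Hessian matrix of second partial derivatives of `f` at `x`. -/
def Hess (f : (Fin 2 → ℝ) → ℝ) (x : Fin 2 → ℝ) : Matrix (Fin 2) (Fin 2) ℝ :=
  Matrix.of fun i j => fderiv ℝ (fun y => fderiv ℝ f y (Pi.single j 1)) x (Pi.single i 1)

/-- The form `Q_x(ζ) = det (ζ₁ Hess φ₁(x) + ζ₂ Hess φ₂(x))`. -/
def Qform (φ : (Fin 2 → ℝ) → Fin 2 → ℝ) (x ζ : Fin 2 → ℝ) : ℝ :=
  (ζ 0 • Hess (fun y => φ y 0) x + ζ 1 • Hess (fun y => φ y 1) x).det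

/-- `x` is an elliptic point for `φ`: `min_{ζ ∈ S¹} |Q_x(ζ)| > 0`. -/
def Elliptic (φ : (Fin 2 → ℝ) → Fin 2 → ℝ) (x : Fin 2 → ℝ) : Prop :=
  ∃ ε : ℝ, 0 < ε ∧ ∀ ζ : Fin 2 → ℝ, onS1 ζ → ε ≤ |Qform φ x ζ|

/-- The symmetric matrix `K(x)` associated with the quadratic form `Q_x`,
i.e. the matrix with entries `k₁₁ = det Hess φ₁`, `k₂₂ = det Hess φ₂`,
`k₁₂ = k₂₁ = ½(∂₁₁φ₁ ∂₂₂φ₂ + ∂₂₂φ₁ ∂₁₁φ₂ − 2 ∂₁₂φ₁ ∂₁₂φ₂)`, which satisfies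
`Q_x(ζ) = ⟨K(x)ζ, ζ⟩`. -/
def Kmat (φ : (Fin 2 → ℝ) → Fin 2 → ℝ) (x : Fin 2 → ℝ) : Matrix (Fin 2) (Fin 2) ℝ :=
  Matrix.of
    ![![(Hess (fun y => φ y 0) x).det,
        ((Hess (fun y => φ y 0) x) 0 0 * (Hess (fun y => φ y 1) x) 1 1
          + (Hess (fun y => φ y 0) x) 1 1 * (Hess (fun y => φ y 1) x) 0 0
          - 2 * (Hess (fun y => φ y 0) x) 0 1 * (Hess (fun y => φ y 1) x) 0 1) / 2],
      ![((Hess (fun y => φ y 0) x) 0 0 * (Hess (fun y => φ y 1) x) 1 1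
          + (Hess (fun y => φ y 0) x) 1 1 * (Hess (fun y => φ y 1) x) 0 0
          - 2 * (Hess (fun y => φ y 0) x) 0 1 * (Hess (fun y => φ y 1) x) 0 1) / 2,
        (Hess (fun y => φ y 1) x).det]]

/-- The function `G(ζ,s) = ⟨φ(1,s), ζ⟩`. -/
def Gfun (φ : (Fin 2 → ℝ) → Fin 2 → ℝ) (ζ : Fin 2 → ℝ) (s : ℝ) : ℝ :=
  dot2 (φ ![1, s]) ζ

/-- The standard inner product on `ℝ⁴`. -/
def dot4 (u v : Fin 4 → ℝ) : ℝ := u 0 * v 0 + u 1 * v 1 + u 2 * v 2 + u 3 * v 3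

/-- The graph map `x ↦ (x, φ(x)) ∈ ℝ⁴`. -/
def graphMap (φ : (Fin 2 → ℝ) → Fin 2 → ℝ) (x : Fin 2 → ℝ) : Fin 4 → ℝ :=
  ![x 0, x 1, φ x 0, φ x 1]

/-- The Fourier transform on `ℝ⁴`, `ĝ(ξ) = ∫ e^{-i⟨x,ξ⟩} g(x) dx`. -/
def ftrans (g : (Fin 4 → ℝ) → ℂ) (ξ : Fin 4 → ℝ) : ℂ :=
  ∫ x : Fin 4 → ℝ, Complex.exp (-Complex.I * (dot4 x ξ : ℂ)) * g x

/-- The Fourier transform of the measure `μ`,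
`μ̂(ξ) = ∫_{V₁^{c,d}} e^{-i⟨(x,φ(x)),ξ⟩} dx`. -/
def muHat (α₁ α₂ c d : ℝ) (φ : (Fin 2 → ℝ) → Fin 2 → ℝ) (ξ : Fin 4 → ℝ) : ℂ :=
  ∫ x in V1 α₁ α₂ c d, Complex.exp (-Complex.I * (dot4 (graphMap φ x) ξ : ℂ))

/-- Convolution with the measure `μ`: `(μ ∗ g)(y) = ∫_{V₁^{c,d}} g(y − (x, φ(x))) dx`. -/
def muConv (α₁ α₂ c d : ℝ) (φ : (Fin 2 → ℝ) → Fin 2 → ℝ) (g : (Fin 4 → ℝ) → ℂ)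
    (y : Fin 4 → ℝ) : ℂ :=
  ∫ x in V1 α₁ α₂ c d, g (y - graphMap φ x)


/-- The function `H(ζ,s)` of Remark 2.4 / Statement 19, built from `G(ζ,s) = ⟨φ(1,s),ζ⟩`. -/
def Hfun (α₁ α₂ m : ℝ) (φ : (Fin 2 → ℝ) → Fin 2 → ℝ) (ζ : Fin 2 → ℝ) (s : ℝ) : ℝ :=
  m * (m - α₁) * Gfun φ ζ s * deriv (deriv (Gfun φ ζ)) s
    + α₂ * (α₁ - α₂) * s * deriv (Gfun φ ζ) s * deriv (deriv (Gfun φ ζ)) s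
    - (m - α₂) ^ 2 * (deriv (Gfun φ ζ) s) ^ 2

theorem Vab_mem_nhds {α₁ α₂ a b s : ℝ} (hα₁ : 0 < α₁) (has : a < s) (hsb : s < b) :
    Vab α₁ α₂ a b ∈ nhds (![1, s] : Fin 2 → ℝ) := by
  have h0 : ContinuousAt (fun x : Fin 2 → ℝ => x 0) ![1, s] := (continuous_apply 0).continuousAt
  have h1 : ContinuousAt (fun x : Fin 2 → ℝ => x 1) ![1, s] := (continuous_apply 1).continuousAt
  have hc : ContinuousAt (fun x : Fin 2 → ℝ => x 1 / (x 0 ^ (α₁⁻¹)) ^ α₂) ![1, s] := by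
    refine h1.div ((h0.rpow_const (by simp)).rpow_const (by simp)) (by simp)
  have hpos : ∀ᶠ x in nhds (![1, s] : Fin 2 → ℝ), 0 < x 0 :=
    h0.eventually (lt_mem_nhds (by simp))
  have hlo : ∀ᶠ x in nhds (![1, s] : Fin 2 → ℝ), a < x 1 / (x 0 ^ (α₁⁻¹)) ^ α₂ :=
    hc.eventually (lt_mem_nhds (by simpa using has))
  have hhi : ∀ᶠ x in nhds (![1, s] : Fin 2 → ℝ), x 1 / (x 0 ^ (α₁⁻¹)) ^ α₂ < b :=
    hc.eventually (gt_mem_nhds (by simpa using hsb))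
  filter_upwards [hpos, hlo, hhi] with x hx hxa hxb
  refine ⟨_, x 0 ^ (α₁⁻¹), hxa, hxb, by positivity, ?_⟩
  have hne : (x 0 ^ (α₁⁻¹)) ^ α₂ ≠ 0 := by positivity
  ext i
  fin_cases i
  · simp [dil, Real.rpow_inv_rpow hx.le hα₁.ne']
  · simp [dil, mul_div_cancel₀ _ hne]

theorem clm_apply_fin_two (L : (Fin 2 → ℝ) →L[ℝ] ℝ) (v : Fin 2 → ℝ) :
    L v = v 0 * L (Pi.single 0 1) + v 1 * L (Pi.single 1 1) := by
  have hv : v = v 0 • (Pi.single 0 1 : Fin 2 → ℝ) + v 1 • (Pi.single 1 1 : Fin 2 → ℝ) := by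
    ext i; fin_cases i <;> simp
  conv_lhs => rw [hv]
  simp

/-- The Euler identity for functions homogeneous with respect to the dilations. -/
theorem euler_identity {α₁ α₂ m : ℝ} {f : (Fin 2 → ℝ) → ℝ} {x : Fin 2 → ℝ}
    (hf : DifferentiableAt ℝ f x)
    (hhom : ∀ t : ℝ, 0 < t → f (dil α₁ α₂ t x) = t ^ m * f x) :
    α₁ * x 0 * fderiv ℝ f x (Pi.single 0 1) + α₂ * x 1 * fderiv ℝ f x (Pi.single 1 1)
      = m * f x := by
  have hrpow (r : ℝ) : HasDerivAt (fun t : ℝ => t ^ r) r 1 := by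
    simpa using Real.hasDerivAt_rpow_const (x := 1) (p := r) (Or.inl one_ne_zero)
  have hd1 : dil α₁ α₂ 1 x = x := by
    ext i; fin_cases i <;> simp [dil]
  have hdil : HasDerivAt (fun t => dil α₁ α₂ t x) ![α₁ * x 0, α₂ * x 1] 1 := by
    rw [hasDerivAt_pi]
    intro i
    fin_cases i
    · simpa [dil] using (hrpow α₁).mul_const (x 0)
    · simpa [dil] using (hrpow α₂).mul_const (x 1)
  have hcomp : HasDerivAt (fun t => f (dil α₁ α₂ t x))
      (fderiv ℝ f x ![α₁ * x 0, α₂ * x 1]) 1 := by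
    have hf' : HasFDerivAt f (fderiv ℝ f x) (dil α₁ α₂ 1 x) := by
      rw [hd1]; exact hf.hasFDerivAt
    exact hf'.comp_hasDerivAt (1 : ℝ) hdil
  have hpow : HasDerivAt (fun t => f (dil α₁ α₂ t x)) (m * f x) 1 := by
    refine ((hrpow m).mul_const (f x)).congr_of_eventuallyEq ?_
    filter_upwards [lt_mem_nhds (zero_lt_one' ℝ)] with t ht using hhom t ht
  have := hcomp.unique hpow
  rw [clm_apply_fin_two] at this
  simpa using this

theorem hasDerivAt_one_cons (s : ℝ) :
    HasDerivAt (fun r : ℝ => (![1, r] : Fin 2 → ℝ)) (Pi.single 1 1) s := by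
  rw [hasDerivAt_pi]
  intro i
  fin_cases i
  · simpa using hasDerivAt_const s (1 : ℝ)
  · simpa using hasDerivAt_id' s

theorem AnalyticAt.fderiv_apply {f : (Fin 2 → ℝ) → ℝ} {x : Fin 2 → ℝ} (hf : AnalyticAt ℝ f x)
    (v : Fin 2 → ℝ) : AnalyticAt ℝ (fun y => fderiv ℝ f y v) x :=
  (ContinuousLinearMap.apply ℝ ℝ v).analyticAt _ |>.comp hf.fderiv

theorem AnalyticAt.hess_symm {f : (Fin 2 → ℝ) → ℝ} {x : Fin 2 → ℝ} (hf : AnalyticAt ℝ f x) :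
    Hess f x 1 0 = Hess f x 0 1 := by
  have hsymm : IsSymmSndFDerivAt ℝ f x :=
    (hf.contDiffAt (n := 2)).isSymmSndFDerivAt (by simp)
  have key (v w : Fin 2 → ℝ) :
      fderiv ℝ (fun y => fderiv ℝ f y v) x w = fderiv ℝ (fderiv ℝ f) x w v := by
    rw [fderiv_clm_apply hf.fderiv.differentiableAt (differentiableAt_const v)]
    simp
  simp only [Hess, Matrix.of_apply, key]
  exact hsymm _ _

theorem AnalyticAt.deriv_line {f : (Fin 2 → ℝ) → ℝ} {s : ℝ} (hf : AnalyticAt ℝ f ![1, s]) :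
    deriv (fun r => f ![1, r]) s = fderiv ℝ f ![1, s] (Pi.single 1 1) :=
  (hf.differentiableAt.hasFDerivAt.comp_hasDerivAt s (hasDerivAt_one_cons s)).deriv

theorem AnalyticAt.deriv_deriv_line {f : (Fin 2 → ℝ) → ℝ} {s : ℝ}
    (hf : AnalyticAt ℝ f ![1, s]) :
    deriv (deriv (fun r => f ![1, r])) s = Hess f ![1, s] 1 1 := by
  have hev : deriv (fun r => f ![1, r]) =ᶠ[nhds s]
      fun r => fderiv ℝ f ![1, r] (Pi.single 1 1) := by
    filter_upwards [(hasDerivAt_one_cons s).continuousAt.eventually hf.eventually_analyticAt]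
      with r hr using hr.deriv_line
  rw [hev.deriv_eq]
  exact (hf.fderiv_apply _).deriv_line

/-- The Hessian of a homogeneous function on the line `x₁ = 1`, in terms of the restriction
of the function to that line. -/
theorem hess_relations {α₁ α₂ m s : ℝ} {f : (Fin 2 → ℝ) → ℝ} (hf : AnalyticAt ℝ f ![1, s])
    (hhom : ∀ᶠ x in nhds (![1, s] : Fin 2 → ℝ), ∀ t : ℝ, 0 < t →
      f (dil α₁ α₂ t x) = t ^ m * f x) :
    α₁ * Hess f ![1, s] 0 1 = (m - α₂) * deriv (fun r => f ![1, r]) s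
        - α₂ * s * deriv (deriv (fun r => f ![1, r])) s ∧
    α₁ ^ 2 * Hess f ![1, s] 0 0
      = (m - α₁) * (m * f ![1, s] - α₂ * s * deriv (fun r => f ![1, r]) s)
        - α₂ * s * (α₁ * Hess f ![1, s] 0 1) := by
  set p : Fin 2 → ℝ := ![1, s] with hp
  have hev : (fun x : Fin 2 → ℝ => α₁ * x 0 * fderiv ℝ f x (Pi.single 0 1)
      + α₂ * x 1 * fderiv ℝ f x (Pi.single 1 1)) =ᶠ[nhds p] fun x => m * f x := by
    filter_upwards [hhom, hf.eventually_analyticAt] with x hx hfx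
    exact euler_identity hfx.differentiableAt hx
  have hD (j : Fin 2) : HasFDerivAt (fun x => fderiv ℝ f x (Pi.single j 1))
      (fderiv ℝ (fun x => fderiv ℝ f x (Pi.single j 1)) p) p :=
    (hf.fderiv_apply _).differentiableAt.hasFDerivAt
  have hproj (j : Fin 2) : HasFDerivAt (fun x : Fin 2 → ℝ => x j)
      (ContinuousLinearMap.proj (R := ℝ) (φ := fun _ : Fin 2 => ℝ) j) p :=
    (ContinuousLinearMap.proj (R := ℝ) (φ := fun _ : Fin 2 => ℝ) j).hasFDerivAt
  have hL := (((hproj 0).const_mul α₁).mul (hD 0)).add (((hproj 1).const_mul α₂).mul (hD 1))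
  have hR := (hf.differentiableAt.hasFDerivAt.const_mul m).congr_of_eventuallyEq hev
  have huniq := hL.unique hR
  have e0 := DFunLike.congr_fun huniq (Pi.single 0 1)
  have e1 := DFunLike.congr_fun huniq (Pi.single 1 1)
  have e := hev.self_of_nhds
  have hs := hf.hess_symm
  rw [hf.deriv_line, hf.deriv_deriv_line]
  simp [hp] at e0 e1 e
  simp only [Hess, Matrix.of_apply, hp] at hs ⊢
  constructor
  · linear_combination e1 - α₁ * hs
  · linear_combination α₁ * e0 + (m - α₁) * e

/-- The restriction of the `i`-th component of `φ` to the line `x₁ = 1`. -/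
def lineComp (φ : (Fin 2 → ℝ) → Fin 2 → ℝ) (i : Fin 2) (s : ℝ) : ℝ := φ ![1, s] i

theorem analyticAt_component {φ : (Fin 2 → ℝ) → Fin 2 → ℝ} {x : Fin 2 → ℝ}
    (hφ : AnalyticAt ℝ φ x) (i : Fin 2) : AnalyticAt ℝ (fun y => φ y i) x :=
  analyticAt_pi_iff.mp hφ i

theorem analyticAt_lineComp {φ : (Fin 2 → ℝ) → Fin 2 → ℝ} {s : ℝ}
    (hφ : AnalyticAt ℝ φ ![1, s]) (i : Fin 2) : AnalyticAt ℝ (lineComp φ i) s := by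
  have hline : AnalyticAt ℝ (fun r : ℝ => (![1, r] : Fin 2 → ℝ)) s := by
    rw [analyticAt_pi_iff]
    intro j
    fin_cases j
    · simpa using analyticAt_const
    · exact analyticAt_id
  exact (analyticAt_component hφ i).comp_of_eq hline rfl

theorem deriv_Gfun {φ : (Fin 2 → ℝ) → Fin 2 → ℝ} {s : ℝ} (hφ : AnalyticAt ℝ φ ![1, s])
    (ζ : Fin 2 → ℝ) :
    deriv (Gfun φ ζ) s = deriv (lineComp φ 0) s * ζ 0 + deriv (lineComp φ 1) s * ζ 1 :=
  (((analyticAt_lineComp hφ 0).differentiableAt.hasDerivAt.mul_const _).add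
    ((analyticAt_lineComp hφ 1).differentiableAt.hasDerivAt.mul_const _)).deriv

theorem deriv_deriv_Gfun {φ : (Fin 2 → ℝ) → Fin 2 → ℝ} {s : ℝ} (hφ : AnalyticAt ℝ φ ![1, s])
    (ζ : Fin 2 → ℝ) :
    deriv (deriv (Gfun φ ζ)) s
      = deriv (deriv (lineComp φ 0)) s * ζ 0 + deriv (deriv (lineComp φ 1)) s * ζ 1 := by
  have hev : deriv (Gfun φ ζ) =ᶠ[nhds s]
      fun r => deriv (lineComp φ 0) r * ζ 0 + deriv (lineComp φ 1) r * ζ 1 := by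
    filter_upwards [(hasDerivAt_one_cons s).continuousAt.eventually hφ.eventually_analyticAt]
      with r hr using deriv_Gfun hr ζ
  rw [hev.deriv_eq]
  exact (((analyticAt_lineComp hφ 0).deriv.differentiableAt.hasDerivAt.mul_const _).add
    ((analyticAt_lineComp hφ 1).deriv.differentiableAt.hasDerivAt.mul_const _)).deriv

theorem Hfun_eq_Qform {α₁ α₂ m s : ℝ} {φ : (Fin 2 → ℝ) → Fin 2 → ℝ}
    (hφ : AnalyticAt ℝ φ ![1, s])
    (hhom : ∀ᶠ x in nhds (![1, s] : Fin 2 → ℝ), ∀ t : ℝ, 0 < t →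
      φ (dil α₁ α₂ t x) = t ^ m • φ x) (ζ : Fin 2 → ℝ) :
    Hfun α₁ α₂ m φ ζ s = α₁ ^ 2 * Qform φ ![1, s] ζ := by
  have hi (i : Fin 2) : AnalyticAt ℝ (fun y => φ y i) ![1, s] := analyticAt_component hφ i
  have hhomi (i : Fin 2) : ∀ᶠ x in nhds (![1, s] : Fin 2 → ℝ), ∀ t : ℝ, 0 < t →
      φ (dil α₁ α₂ t x) i = t ^ m * φ x i := by
    filter_upwards [hhom] with x hx t ht
    simp [hx t ht]
  obtain ⟨r0, q0⟩ := hess_relations (hi 0) (hhomi 0)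
  obtain ⟨r1, q1⟩ := hess_relations (hi 1) (hhomi 1)
  have d0 := (hi 0).deriv_deriv_line
  have d1 := (hi 1).deriv_deriv_line
  have s0 := (hi 0).hess_symm
  have s1 := (hi 1).hess_symm
  rw [Hfun, deriv_Gfun hφ, deriv_deriv_Gfun hφ, Gfun, dot2, Qform, Matrix.det_fin_two]
  simp only [Matrix.add_apply, Matrix.smul_apply, smul_eq_mul, s0, s1, ← d0, ← d1]
  rw [r0] at q0
  rw [r1] at q1
  change _ = (m - α₂) * deriv (lineComp φ 0) s - α₂ * s * deriv (deriv (lineComp φ 0)) s at r0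
  change _ = (m - α₂) * deriv (lineComp φ 1) s - α₂ * s * deriv (deriv (lineComp φ 1)) s at r1
  change _ = (m - α₁) * (m * φ ![1, s] 0 - α₂ * s * deriv (lineComp φ 0) s)
    - α₂ * s * ((m - α₂) * deriv (lineComp φ 0) s
      - α₂ * s * deriv (deriv (lineComp φ 0)) s) at q0
  change _ = (m - α₁) * (m * φ ![1, s] 1 - α₂ * s * deriv (lineComp φ 1) s)
    - α₂ * s * ((m - α₂) * deriv (lineComp φ 1) s
      - α₂ * s * deriv (deriv (lineComp φ 1)) s) at q1
  change _ = α₁ ^ 2 * ((_ + _) *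
    (ζ 0 * deriv (deriv (lineComp φ 0)) s + ζ 1 * deriv (deriv (lineComp φ 1)) s) - _)
  generalize deriv (deriv (lineComp φ 0)) s = b0 at *
  generalize deriv (deriv (lineComp φ 1)) s = b1 at *
  generalize deriv (lineComp φ 0) s = a0 at *
  generalize deriv (lineComp φ 1) s = a1 at *
  generalize Hess (fun y => φ y 0) ![1, s] 0 1 = u0 at *
  generalize Hess (fun y => φ y 1) ![1, s] 0 1 = u1 at *
  have hr : α₁ * (ζ 0 * u0 + ζ 1 * u1)
      = ζ 0 * ((m - α₂) * a0 - α₂ * s * b0) + ζ 1 * ((m - α₂) * a1 - α₂ * s * b1) := by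
    linear_combination ζ 0 * r0 + ζ 1 * r1
  have hr2 := congrArg (· ^ 2) hr
  linear_combination hr2 - (ζ 0 * b0 + ζ 1 * b1) * (ζ 0 * q0 + ζ 1 * q1)

/-- A binary quadratic form without zeros on the unit circle has positive determinant. -/
theorem det_pos_of_ne_zero {A B C : ℝ}
    (h : ∀ ζ : Fin 2 → ℝ, onS1 ζ → A * ζ 0 ^ 2 + B * ζ 0 * ζ 1 + C * ζ 1 ^ 2 ≠ 0) :
    0 < A * C - B ^ 2 / 4 := by
  by_contra! hle
  have hdisc : 0 ≤ B ^ 2 - 4 * A * C := by linarith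
  have hA : A ≠ 0 := by
    rintro rfl
    exact h ![1, 0] (by simp [onS1]) (by simp)
  set x := -B + √(B ^ 2 - 4 * A * C) with hx
  have hsq := Real.sq_sqrt hdisc
  have hN : 0 < x ^ 2 + (2 * A) ^ 2 := by positivity
  have hN2 := Real.sq_sqrt hN.le
  set N := √(x ^ 2 + (2 * A) ^ 2) with hNdef
  have hN0 : N ≠ 0 := (Real.sqrt_pos.mpr hN).ne'
  have hzero : A * x ^ 2 + B * x * (2 * A) + C * (2 * A) ^ 2 = 0 := by
    rw [hx]; linear_combination A * hsq
  refine h ![x / N, 2 * A / N] ?_ ?_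
  · simp only [onS1, Matrix.cons_val_zero, Matrix.cons_val_one]
    field_simp
    linear_combination -hN2
  · simp only [Matrix.cons_val_zero, Matrix.cons_val_one]
    field_simp
    linear_combination hzero

theorem det_le_mul_abs_form {A B C M : ℝ} (hM : |A + C| ≤ M) {ζ : Fin 2 → ℝ} (hζ : onS1 ζ) :
    A * C - B ^ 2 / 4 ≤ M * |A * ζ 0 ^ 2 + B * ζ 0 * ζ 1 + C * ζ 1 ^ 2| := by
  have hζ' : ζ 0 ^ 2 + ζ 1 ^ 2 = 1 := hζ
  calc A * C - B ^ 2 / 4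
      ≤ (A + C) * (A * ζ 0 ^ 2 + B * ζ 0 * ζ 1 + C * ζ 1 ^ 2) := by
        have h1 := sq_nonneg (A * ζ 0 + B / 2 * ζ 1)
        have h2 := sq_nonneg (B / 2 * ζ 0 + C * ζ 1)
        have h3 : (A + C) * (A * ζ 0 ^ 2 + B * ζ 0 * ζ 1 + C * ζ 1 ^ 2)
            - (A * C - B ^ 2 / 4) * (ζ 0 ^ 2 + ζ 1 ^ 2)
            = (A * ζ 0 + B / 2 * ζ 1) ^ 2 + (B / 2 * ζ 0 + C * ζ 1) ^ 2 := by ring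
        rw [hζ'] at h3
        linarith
    _ ≤ |A + C| * |A * ζ 0 ^ 2 + B * ζ 0 * ζ 1 + C * ζ 1 ^ 2| := by
        rw [← abs_mul]; exact le_abs_self _
    _ ≤ _ := by gcongr

/-- Finite order of vanishing: a polynomial lower bound near a zero of an analytic function. -/
theorem AnalyticAt.exists_pow_le_abs {f : ℝ → ℝ} {σ : ℝ} (hf : AnalyticAt ℝ f σ)
    (hne : ¬ ∀ᶠ s in nhds σ, f s = 0) :
    ∃ n : ℕ, 0 < n ∧ ∃ D : ℝ, 0 < D ∧ ∃ δ : ℝ, 0 < δ ∧ ∀ s, |s - σ| < δ →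
      D * |s - σ| ^ n ≤ |f s| := by
  obtain ⟨n, g, hg, hg0, hev⟩ := hf.exists_eventuallyEq_pow_smul_nonzero_iff.mpr hne
  have hgev : ∀ᶠ s in nhds σ, |g σ| / 2 < |g s| :=
    hg.continuousAt.abs.eventually (lt_mem_nhds (half_lt_self (abs_pos.mpr hg0)))
  obtain ⟨δ, hδ, hball⟩ := Metric.eventually_nhds_iff.mp (hev.and hgev)
  refine ⟨n + 1, n.succ_pos, |g σ| / 2, by positivity, min δ 1, by positivity, fun s hs => ?_⟩
  obtain ⟨hfs, hgs⟩ := hball (y := s) (by rw [Real.dist_eq]; exact hs.trans_le (min_le_left _ _))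
  have h1 : |s - σ| ≤ 1 := hs.le.trans (min_le_right _ _)
  rw [hfs, smul_eq_mul, abs_mul, abs_pow, mul_comm]
  exact mul_le_mul (pow_le_pow_of_le_one (abs_nonneg _) h1 n.le_succ) hgs.le (by positivity)
    (by positivity)

/-- Coefficient of the quadratic form `ζ ↦ H(ζ,s)`, as the polarization of `H` evaluated at the
components `i` and `j`. -/
def Hcoef (α₁ α₂ m : ℝ) (φ : (Fin 2 → ℝ) → Fin 2 → ℝ) (i j : Fin 2) (s : ℝ) : ℝ :=
  m * (m - α₁) * lineComp φ i s * deriv (deriv (lineComp φ j)) s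
    + α₂ * (α₁ - α₂) * s * deriv (lineComp φ i) s * deriv (deriv (lineComp φ j)) s
    - (m - α₂) ^ 2 * (deriv (lineComp φ i) s * deriv (lineComp φ j) s)

theorem analyticAt_Hcoef {α₁ α₂ m s : ℝ} {φ : (Fin 2 → ℝ) → Fin 2 → ℝ}
    (hφ : AnalyticAt ℝ φ ![1, s]) (i j : Fin 2) :
    AnalyticAt ℝ (Hcoef α₁ α₂ m φ i j) s := by
  have h0 (k : Fin 2) := analyticAt_lineComp hφ k
  have h1 (k : Fin 2) := (h0 k).deriv
  have h2 (k : Fin 2) := (h1 k).deriv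
  exact (((analyticAt_const.mul (h0 i)).mul (h2 j)).add
    (((analyticAt_const.mul analyticAt_id).mul (h1 i)).mul (h2 j))).sub
    (analyticAt_const.mul ((h1 i).mul (h1 j)))

theorem Hfun_eq_form {α₁ α₂ m s : ℝ} {φ : (Fin 2 → ℝ) → Fin 2 → ℝ}
    (hφ : AnalyticAt ℝ φ ![1, s]) (ζ : Fin 2 → ℝ) :
    Hfun α₁ α₂ m φ ζ s = Hcoef α₁ α₂ m φ 0 0 s * ζ 0 ^ 2
      + (Hcoef α₁ α₂ m φ 0 1 s + Hcoef α₁ α₂ m φ 1 0 s) * ζ 0 * ζ 1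
      + Hcoef α₁ α₂ m φ 1 1 s * ζ 1 ^ 2 := by
  rw [Hfun, deriv_Gfun hφ, deriv_deriv_Gfun hφ, Gfun, dot2]
  simp only [Hcoef, lineComp]
  ring

theorem mem_closure_Vab {α₁ α₂ c d s : ℝ} (hcd : c < d) (hs : s ∈ Icc c d) :
    (![1, s] : Fin 2 → ℝ) ∈ closure (Vab α₁ α₂ c d) := by
  have hmaps : MapsTo (fun r : ℝ => (![1, r] : Fin 2 → ℝ)) (Ioo c d) (Vab α₁ α₂ c d) := by
    intro r hr
    refine ⟨r, 1, hr.1, hr.2, one_pos, ?_⟩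
    ext i; fin_cases i <;> simp [dil]
  have hcont : Continuous fun r : ℝ => (![1, r] : Fin 2 → ℝ) :=
    continuous_iff_continuousAt.mpr fun r => (hasDerivAt_one_cons r).continuousAt
  refine hmaps.closure hcont ?_
  rwa [closure_Ioo hcd.ne]

/-- Lower bounds for `H(ζ,s)`: (i)–(ii) near `σ` with rates `|s−σ|^{nⱼ}`, and
(iii) a uniform positive lower bound on closed subintervals of `[c,d]` avoiding `σ`. -/
theorem stmt_19 (α₁ α₂ m a b : ℝ) (φ : (Fin 2 → ℝ) → Fin 2 → ℝ)
    (hα₁ : 0 < α₁) (hα₂ : 0 < α₂) (hαne : α₁ ≠ α₂) (hab : a < b)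
    (hm : 3 * (α₁ + α₂) ≤ m)
    (H1 : AnalyticOnNhd ℝ φ (Vab α₁ α₂ a b))
    (H2 : ∀ x ∈ Vab α₁ α₂ a b, ∀ t : ℝ, 0 < t → φ (dil α₁ α₂ t x) = t ^ m • φ x)
    (c d σ : ℝ) (hac : a < c) (hcd : c < d) (hdb : d < b) (hσ : σ ∈ Set.Icc c d)
    (H3 : {x | x ∈ closure (Vab α₁ α₂ c d) ∧ x ≠ 0 ∧ ¬ Elliptic φ x}
        = {x | ∃ t : ℝ, 0 < t ∧ x = dil α₁ α₂ t ![1, σ]}) :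
    (σ ∈ Set.Ioc c d → ∃ n₁ : ℕ, 0 < n₁ ∧ ∃ D : ℝ, 0 < D ∧ ∃ δ : ℝ, 0 < δ ∧
      ∀ s ∈ Set.Ioo (σ - δ) σ, ∀ ζ : Fin 2 → ℝ, onS1 ζ →
        D * |s - σ| ^ n₁ ≤ |Hfun α₁ α₂ m φ ζ s|) ∧
    (σ ∈ Set.Ico c d → ∃ n₂ : ℕ, 0 < n₂ ∧ ∃ D : ℝ, 0 < D ∧ ∃ δ : ℝ, 0 < δ ∧
      ∀ s ∈ Set.Ioo σ (σ + δ), ∀ ζ : Fin 2 → ℝ, onS1 ζ →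
        D * |s - σ| ^ n₂ ≤ |Hfun α₁ α₂ m φ ζ s|) ∧
    (∀ u v : ℝ, Set.Icc u v ⊆ Set.Icc c d → σ ∉ Set.Icc u v →
      ∃ Dt : ℝ, 0 < Dt ∧ ∀ s ∈ Set.Icc u v, ∀ ζ : Fin 2 → ℝ, onS1 ζ →
        Dt ≤ |Hfun α₁ α₂ m φ ζ s|) := by
  have hmemV (s : ℝ) (hs : s ∈ Icc c d) : Vab α₁ α₂ a b ∈ nhds (![1, s] : Fin 2 → ℝ) :=
    Vab_mem_nhds hα₁ (hac.trans_le hs.1) (hs.2.trans_lt hdb)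
  have hφ (s : ℝ) (hs : s ∈ Icc c d) : AnalyticAt ℝ φ ![1, s] :=
    H1 _ (mem_of_mem_nhds (hmemV s hs))
  have hform (s : ℝ) (hs : s ∈ Icc c d) (ζ : Fin 2 → ℝ) :=
    Hfun_eq_form (α₁ := α₁) (α₂ := α₂) (m := m) (hφ s hs) ζ
  have hell (s : ℝ) (hs : s ∈ Icc c d) (hne : s ≠ σ) : Elliptic φ ![1, s] := by
    by_contra hnot
    have hmem : (![1, s] : Fin 2 → ℝ) ∈ {x | ∃ t : ℝ, 0 < t ∧ x = dil α₁ α₂ t ![1, σ]} := by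
      rw [← H3]
      exact ⟨mem_closure_Vab hcd hs, fun h => by simpa using congrFun h 0, hnot⟩
    obtain ⟨t, ht, hx⟩ := hmem
    have h0 : t ^ α₁ = 1 := by simpa [dil] using (congrFun hx 0).symm
    have ht1 : t = 1 :=
      (Real.rpow_left_inj ht.le zero_le_one hα₁.ne').mp (h0.trans (Real.one_rpow α₁).symm)
    subst ht1
    exact hne (by simpa [dil] using congrFun hx 1)
  have hHne (s : ℝ) (hs : s ∈ Icc c d) (hne : s ≠ σ) (ζ : Fin 2 → ℝ) (hζ : onS1 ζ) :
      Hfun α₁ α₂ m φ ζ s ≠ 0 := by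
    have hhom : ∀ᶠ x in nhds (![1, s] : Fin 2 → ℝ), ∀ t : ℝ, 0 < t →
        φ (dil α₁ α₂ t x) = t ^ m • φ x := by
      filter_upwards [hmemV s hs] with x hx using H2 x hx
    rw [Hfun_eq_Qform (hφ s hs) hhom]
    obtain ⟨ε, hε, hQ⟩ := hell s hs hne
    exact mul_ne_zero (pow_ne_zero _ hα₁.ne') (abs_pos.mp (hε.trans_le (hQ ζ hζ)))
  set Δ : ℝ → ℝ := fun s => Hcoef α₁ α₂ m φ 0 0 s * Hcoef α₁ α₂ m φ 1 1 s
    - (Hcoef α₁ α₂ m φ 0 1 s + Hcoef α₁ α₂ m φ 1 0 s) ^ 2 / 4 with hΔ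
  have hΔan (s : ℝ) (hs : s ∈ Icc c d) : AnalyticAt ℝ Δ s := by
    have hc (i j : Fin 2) := analyticAt_Hcoef (α₁ := α₁) (α₂ := α₂) (m := m) (hφ s hs) i j
    exact ((hc 0 0).mul (hc 1 1)).sub ((((hc 0 1).add (hc 1 0)).pow 2).div_const)
  have hΔpos (s : ℝ) (hs : s ∈ Icc c d) (hne : s ≠ σ) : 0 < Δ s :=
    det_pos_of_ne_zero fun ζ hζ => by rw [← hform s hs]; exact hHne s hs hne ζ hζ
  obtain ⟨M, hM⟩ : ∃ M : ℝ, ∀ s ∈ Icc c d,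
      |Hcoef α₁ α₂ m φ 0 0 s + Hcoef α₁ α₂ m φ 1 1 s| ≤ M := by
    simp_rw [← Real.norm_eq_abs]
    refine isCompact_Icc.exists_bound_of_continuousOn fun s hs => ?_
    exact ((analyticAt_Hcoef (hφ s hs) 0 0).add
      (analyticAt_Hcoef (hφ s hs) 1 1)).continuousAt.continuousWithinAt
  have hM0 : 0 ≤ M := (abs_nonneg _).trans (hM c ⟨le_rfl, hcd.le⟩)
  have hbound (s : ℝ) (hs : s ∈ Icc c d) (ζ : Fin 2 → ℝ) (hζ : onS1 ζ) :
      Δ s / (M + 1) ≤ |Hfun α₁ α₂ m φ ζ s| := by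
    rw [div_le_iff₀' (by positivity), hform s hs]
    exact det_le_mul_abs_form ((hM s hs).trans (by linarith)) hζ
  have hΔne : ¬ ∀ᶠ s in nhds σ, Δ s = 0 := by
    intro hev
    obtain ⟨ε, hε, hball⟩ := Metric.eventually_nhds_iff.mp hev
    rcases hσ.2.lt_or_eq with h | h
    · have hpos : 0 < min (ε / 2) (d - σ) := lt_min (by positivity) (by linarith)
      have hle := min_le_right (ε / 2) (d - σ)
      refine (hΔpos (σ + min (ε / 2) (d - σ)) ⟨by linarith [hσ.1], by linarith⟩
        (by linarith)).ne' (hball ?_)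
      rw [Real.dist_eq, add_sub_cancel_left, abs_of_pos hpos]
      linarith [min_le_left (ε / 2) (d - σ)]
    · have hpos : 0 < min (ε / 2) (σ - c) := lt_min (by positivity) (by linarith)
      have hle := min_le_right (ε / 2) (σ - c)
      refine (hΔpos (σ - min (ε / 2) (σ - c)) ⟨by linarith, by linarith⟩
        (by linarith)).ne' (hball ?_)
      rw [Real.dist_eq, sub_sub_cancel_left, abs_neg, abs_of_pos hpos]
      linarith [min_le_left (ε / 2) (σ - c)]
  obtain ⟨n, hn, D, hD, δ, hδ, hlow⟩ := (hΔan σ hσ).exists_pow_le_abs hΔne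
  have hnear (s : ℝ) (hs : s ∈ Icc c d) (hne : s ≠ σ) (hsδ : |s - σ| < δ) (ζ : Fin 2 → ℝ)
      (hζ : onS1 ζ) : D / (M + 1) * |s - σ| ^ n ≤ |Hfun α₁ α₂ m φ ζ s| := by
    refine le_trans ?_ (hbound s hs ζ hζ)
    rw [div_mul_eq_mul_div, ← abs_of_pos (hΔpos s hs hne)]
    gcongr
    exact hlow s hsδ
  refine ⟨fun h => ?_, fun h => ?_, fun u v huv hσuv => ?_⟩
  · refine ⟨n, hn, D / (M + 1), by positivity, min δ (σ - c), lt_min hδ (by linarith [h.1]),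
      fun s hs ζ hζ => hnear s ⟨?_, hs.2.le.trans h.2⟩ hs.2.ne ?_ ζ hζ⟩
    · linarith [hs.1, min_le_right δ (σ - c)]
    · rw [abs_sub_lt_iff]
      constructor <;> linarith [hs.1, hs.2, min_le_left δ (σ - c)]
  · refine ⟨n, hn, D / (M + 1), by positivity, min δ (d - σ), lt_min hδ (by linarith [h.2]),
      fun s hs ζ hζ => hnear s ⟨h.1.trans hs.1.le, ?_⟩ hs.1.ne' ?_ ζ hζ⟩
    · linarith [hs.2, min_le_right δ (d - σ)]
    · rw [abs_sub_lt_iff]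
      constructor <;> linarith [hs.1, hs.2, min_le_left δ (d - σ)]
  · rcases (Icc u v).eq_empty_or_nonempty with hemp | hnon
    · exact ⟨1, one_pos, fun s hs => by simp [hemp] at hs⟩
    · obtain ⟨s₀, hs₀, hmin⟩ := isCompact_Icc.exists_isMinOn hnon
        (fun s hs => (hΔan s (huv hs)).continuousAt.continuousWithinAt)
      have hpos := hΔpos s₀ (huv hs₀) fun h => hσuv (h ▸ hs₀)
      refine ⟨Δ s₀ / (M + 1), by positivity, fun s hs ζ hζ => ?_⟩
      refine le_trans ?_ (hbound s (huv hs) ζ hζ)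
      gcongr
      exact hmin hs

end
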